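/- Let A be the companion matrix of f(x) = (x−1)²(x⁴−x³+x²−x+1) and B the companion matrix of the seventh cyclotomic polynomial g(x) = x⁶+x⁵+x⁴+x³+x²+x+1, regarded as elements of GL₆(ℚ), and set T = B·A⁻¹. Then B⁷ = I, B ≠ I, T has infinite order, and the group homomorphism from the free product ℤ ∗ (ℤ/7ℤ) to GL₆(ℚ) sending the generator 1 of ℤ to T and the generator 1 of ℤ/7ℤ to B is injective; in particular the group ⟨A,B⟩ is isomorphic to ℤ ∗ ℤ/7ℤ. (This is the hypergeometric monodromy group of case C-58, with α = (0,0,1/10,3/10,7/10,9/10) and β = (1/7,2/7,3/7,4/7,5/7,6/7).) -/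

import Mathlib

open Matrix Polynomial

/-- The companion matrix of a (monic degree `n`) polynomial `p`:
the `n × n` matrix with subdiagonal entries `1`, last column
`(-c₀, …, -c_{n-1})ᵀ`, and `0` elsewhere. -/
def companionMatrix {K : Type*} [CommRing K] (n : ℕ) (p : Polynomial K) :
    Matrix (Fin n) (Fin n) K :=
  Matrix.of fun i j =>
    if (j : ℕ) + 1 = n then -p.coeff i
    else if (i : ℕ) = (j : ℕ) + 1 then 1 else 0
namespace HypergeometricPingPong

/-- The generators of the ping-pong cone, as integral vectors. -/
def rays : List (List ℤ) := [
  [0, -4, 7, -8, 8, -7, 4], [1, -3, 4, -4, 4, -3, 1], [1, -3, 3, -2, 2, -2, 1],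
  [1, -2, 2, -3, 3, -2, 1], [1, -3, 4, -4, 3, -2, 1], [1, -3, 4, -4, 4, -4, 2],
  [1, -3, 4, -5, 5, -3, 1], [1, -4, 5, -4, 4, -4, 2], [1, -4, 6, -5, 4, -4, 2],
  [1, -3, 4, -5, 6, -5, 2], [1, -3, 5, -6, 5, -4, 2], [1, -4, 6, -6, 5, -3, 1],
  [2, -5, 5, -5, 5, -3, 1], [1, -4, 7, -8, 7, -5, 2], [1, -5, 7, -7, 6, -4, 2],
  [1, -5, 7, -7, 6, -5, 3], [1, -5, 8, -8, 7, -5, 2], [1, -4, 7, -8, 8, -7, 3],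
  [1, -4, 7, -8, 7, -7, 4], [1, -5, 8, -8, 8, -7, 3], [2, -6, 7, -7, 8, -6, 2],
  [1, -5, 7, -8, 10, -9, 4], [1, -5, 9, -10, 9, -8, 4], [1, -5, 8, -10, 10, -8, 4],
  [1, -5, 9, -11, 11, -8, 3], [1, -5, 9, -10, 10, -10, 5], [1, -6, 9, -11, 12, -10, 5],
  [2, -7, 11, -11, 10, -9, 4], [2, -7, 10, -10, 11, -10, 4], [3, -9, 11, -11, 11, -7, 2],
  [3, -10, 13, -12, 12, -9, 3], [1, -8, 12, -14, 14, -11, 6], [3, -10, 13, -12, 13, -11, 4],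
  [3, -10, 13, -13, 14, -10, 3], [1, -9, 13, -14, 15, -12, 6], [3, -10, 14, -15, 16, -12, 4],
  [3, -11, 17, -17, 16, -13, 5], [3, -11, 17, -18, 18, -14, 5], [4, -14, 20, -19, 18, -14, 5],
  [4, -14, 20, -19, 19, -16, 6], [4, -14, 21, -21, 21, -18, 7], [5, -17, 24, -24, 24, -18, 6],
  [5, -17, 24, -24, 25, -20, 7], [6, -20, 27, -26, 27, -21, 7], [6, -21, 31, -31, 31, -25, 9],
  [7, -24, 34, -33, 33, -26, 9]]

/-- Certificates that `(-1) ^ k • T B ^ k` maps each generator into the cone, for `1 ≤ k ≤ 6`. -/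
def certificates : List (List (ℕ × List (ℕ × ℕ))) := [
  [
    (1, [(0, 2), (4, 2), (13, 1), (21, 1)]), (1, [(0, 1), (5, 1), (11, 1), (23, 1)]),
    (1, [(5, 1), (17, 1), (31, 1)]), (2, [(14, 1), (22, 1), (24, 1), (25, 1)]),
    (1, [(0, 1), (1, 1), (8, 1), (23, 1)]), (1, [(10, 1), (17, 1), (34, 1)]),
    (1, [(0, 1), (6, 1), (16, 1), (18, 1)]), (1, [(0, 2), (6, 1), (18, 1), (20, 1)]),
    (1, [(0, 1), (3, 1), (27, 1), (34, 1)]), (1, [(13, 1), (17, 1), (31, 1)]),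
    (2, [(0, 3), (1, 4), (16, 1), (22, 1)]), (1, [(0, 2), (3, 1), (14, 1), (27, 1)]),
    (1, [(15, 2), (23, 1), (24, 1), (25, 1)]), (1, [(13, 1), (15, 1), (22, 1), (34, 1)]),
    (1, [(0, 3), (1, 2), (2, 1), (10, 2)]), (1, [(0, 2), (5, 3), (14, 1), (24, 1)]),
    (1, [(0, 3), (2, 2), (3, 1), (13, 2)]), (1, [(0, 2), (1, 2), (11, 1), (23, 1)]),
    (1, [(7, 1), (22, 1), (24, 1), (34, 1)]), (1, [(7, 1), (13, 1), (17, 1), (31, 2)]),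
    (1, [(0, 1), (14, 1), (23, 3), (27, 1)]), (1, [(0, 1), (4, 1), (13, 2), (26, 2)]),
    (1, [(0, 2), (9, 2), (15, 1), (16, 2)]), (1, [(0, 3), (1, 3), (10, 1), (13, 1)]),
    (1, [(0, 1), (15, 3), (24, 2)]), (1, [(0, 3), (6, 2), (11, 1), (28, 1)]),
    (1, [(0, 3), (6, 3), (22, 1), (27, 1)]), (1, [(0, 4), (1, 5), (4, 1), (23, 1)]),
    (1, [(0, 1), (11, 3), (18, 1), (26, 3)]), (1, [(0, 4), (6, 5), (8, 2), (18, 2)]),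
    (1, [(10, 1), (17, 1), (27, 2), (31, 4)]), (1, [(0, 1), (10, 3), (19, 3), (31, 2)]),
    (1, [(0, 6), (3, 3), (10, 2), (41, 1)]), (1, [(2, 1), (6, 2), (22, 4), (31, 3)]),
    (1, [(5, 1), (9, 1), (11, 1), (22, 3), (31, 3)]), (1, [(13, 2), (15, 2), (17, 3), (31, 3)]),
    (1, [(0, 3), (7, 3), (11, 3), (23, 5)]), (1, [(0, 6), (6, 7), (8, 3), (18, 1)]),
    (1, [(10, 6), (16, 1), (18, 2), (34, 5)]), (1, [(3, 1), (10, 3), (19, 5), (31, 5)]),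
    (1, [(6, 1), (10, 3), (19, 5), (31, 5)]), (1, [(0, 4), (10, 10), (30, 1), (34, 4)]),
    (1, [(0, 4), (10, 10), (33, 1), (34, 4)]), (1, [(0, 11), (4, 10), (9, 7), (13, 3)]),
    (1, [(0, 13), (10, 8), (20, 2), (29, 3)]), (1, [(1, 7), (22, 6), (27, 1), (31, 9)])],
  [
    (1, [(0, 1), (22, 3), (29, 1), (31, 1)]), (1, [(8, 1), (13, 1), (17, 1), (31, 1)]),
    (1, [(8, 1), (23, 1), (24, 1)]), (1, [(0, 1), (1, 1), (11, 1)]),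
    (1, [(1, 1), (10, 1), (22, 1), (34, 1)]), (1, [(13, 1), (14, 1), (22, 1), (26, 1)]),
    (1, [(8, 1), (13, 1), (19, 1), (31, 1)]), (1, [(6, 1), (16, 1), (22, 2), (26, 1)]),
    (1, [(3, 1), (6, 1), (22, 3), (34, 1)]), (1, [(0, 1), (6, 1), (16, 2), (18, 1)]),
    (1, [(14, 1), (15, 1), (17, 2), (31, 1)]), (1, [(0, 2), (6, 3), (8, 2), (25, 1)]),
    (1, [(0, 1), (5, 2), (16, 2), (24, 1)]), (1, [(8, 1), (10, 3), (22, 1), (34, 2)]),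
    (1, [(14, 2), (17, 3), (18, 1), (34, 1)]), (1, [(15, 1), (16, 1), (19, 2), (23, 3)]),
    (1, [(0, 1), (6, 2), (14, 3), (25, 3)]), (1, [(9, 1), (14, 2), (22, 3), (31, 1)]),
    (1, [(0, 1), (14, 2), (23, 3), (27, 1)]), (1, [(6, 2), (15, 1), (22, 4), (34, 1)]),
    (1, [(0, 1), (11, 4), (23, 1), (25, 2)]), (1, [(16, 3), (18, 2), (24, 1), (31, 1)]),
    (1, [(0, 3), (10, 5), (30, 1), (34, 1)]), (1, [(0, 3), (2, 3), (13, 4), (23, 1)]),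
    (1, [(13, 1), (14, 4), (25, 3), (31, 1)]), (1, [(0, 4), (10, 5), (14, 1), (33, 1)]),
    (1, [(0, 1), (8, 2), (16, 3), (23, 4)]), (1, [(13, 2), (15, 3), (17, 4), (31, 2)]),
    (1, [(11, 1), (13, 4), (18, 3), (34, 2)]), (1, [(0, 3), (4, 5), (17, 2), (19, 3), (24, 1)]),
    (1, [(16, 6), (17, 1), (18, 3), (26, 3)]), (1, [(0, 2), (15, 5), (17, 2), (24, 2), (37, 1)]),
    (1, [(0, 4), (10, 6), (16, 2), (19, 2), (35, 1)]), (1, [(13, 4), (14, 4), (25, 4), (34, 1)]),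
    (1, [(0, 3), (4, 2), (14, 4), (17, 7)]), (1, [(8, 2), (13, 6), (18, 3), (34, 3)]),
    (1, [(0, 8), (1, 6), (10, 7), (38, 1)]), (1, [(0, 6), (1, 1), (4, 7), (14, 2), (17, 7)]),
    (1, [(0, 3), (7, 6), (13, 7), (22, 2), (23, 5)]), (1, [(16, 9), (18, 5), (23, 2), (26, 4)]),
    (1, [(0, 9), (1, 10), (10, 8), (16, 2), (22, 1)]),
    (1, [(15, 11), (16, 1), (19, 1), (24, 7), (25, 4)]),
    (1, [(0, 1), (10, 3), (11, 10), (25, 7), (31, 4)]),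
    (1, [(16, 13), (18, 6), (23, 2), (25, 1), (26, 5)]),
    (1, [(0, 11), (3, 3), (5, 7), (7, 5), (13, 16)]), (1, [(16, 16), (18, 9), (23, 1), (26, 8)])],
  [
    (1, [(0, 1), (14, 3), (15, 1), (17, 4)]), (1, [(15, 2), (19, 1), (24, 1)]),
    (2, [(0, 1), (4, 1), (11, 1), (13, 1), (16, 1)]), (1, [(0, 1), (5, 1), (10, 1), (14, 1)]),
    (1, [(13, 1), (27, 1), (31, 1)]), (1, [(0, 1), (4, 1), (11, 2), (25, 1)]),
    (1, [(0, 2), (1, 3), (10, 1), (15, 1)]), (1, [(0, 1), (7, 1), (11, 1), (13, 2)]),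
    (1, [(11, 1), (16, 2), (23, 1), (25, 1)]), (1, [(8, 2), (16, 1), (23, 1), (31, 1)]),
    (1, [(0, 2), (2, 1), (5, 2), (13, 3)]), (1, [(15, 1), (22, 1), (31, 1), (37, 1)]),
    (1, [(0, 2), (4, 3), (6, 1), (19, 1)]), (1, [(0, 3), (6, 3), (8, 1), (27, 2)]),
    (1, [(0, 3), (1, 4), (10, 2), (11, 1)]), (1, [(0, 1), (10, 1), (14, 3), (17, 3)]),
    (1, [(5, 1), (16, 4), (18, 1), (26, 2)]), (1, [(0, 2), (13, 2), (15, 2), (40, 1)]),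
    (1, [(11, 1), (14, 2), (21, 1), (22, 4)]), (1, [(0, 2), (4, 4), (19, 3), (24, 1)]),
    (1, [(8, 2), (11, 2), (17, 1), (31, 2)]), (1, [(8, 2), (11, 2), (16, 1), (25, 1), (31, 2)]),
    (1, [(14, 5), (17, 1), (24, 1), (25, 3)]), (1, [(13, 1), (14, 5), (25, 3), (26, 1)]),
    (1, [(14, 5), (21, 2), (22, 3), (25, 1)]), (1, [(0, 2), (16, 4), (18, 3), (33, 1)]),
    (1, [(0, 5), (3, 1), (4, 4), (36, 2)]), (1, [(8, 5), (10, 1), (24, 3), (31, 2)]),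
    (1, [(0, 4), (4, 3), (11, 1), (36, 2)]), (1, [(0, 2), (4, 3), (31, 2), (36, 2)]),
    (1, [(14, 1), (15, 5), (19, 3), (24, 3)]), (1, [(14, 6), (21, 2), (22, 5), (23, 1)]),
    (1, [(8, 5), (14, 2), (24, 3), (31, 2)]), (1, [(14, 7), (17, 3), (25, 2), (34, 1)]),
    (1, [(11, 6), (17, 1), (18, 4), (34, 3)]), (1, [(8, 4), (10, 4), (13, 3), (34, 4)]),
    (1, [(0, 6), (4, 6), (8, 1), (22, 1), (37, 3)]),
    (1, [(8, 3), (11, 5), (25, 3), (31, 4), (37, 1)]),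
    (1, [(0, 7), (1, 10), (8, 1), (10, 4), (16, 4)]), (1, [(0, 3), (5, 6), (16, 10), (23, 3)]),
    (1, [(0, 6), (4, 10), (19, 6), (24, 2), (36, 1)]),
    (1, [(0, 7), (4, 6), (6, 1), (31, 2), (36, 5)]), (1, [(8, 7), (16, 7), (23, 8), (34, 2)]),
    (1, [(0, 7), (3, 8), (8, 3), (16, 10), (19, 5)]),
    (1, [(0, 11), (1, 16), (8, 4), (13, 8), (15, 3)]), (1, [(15, 15), (16, 1), (19, 9), (24, 8)])],
  [
    (1, [(8, 2), (10, 3), (13, 1), (34, 2)]), (1, [(8, 1), (10, 2), (34, 1)]),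
    (3, [(0, 1), (8, 2), (10, 1), (14, 1), (15, 2)]), (1, [(0, 1), (1, 1), (27, 1)]),
    (1, [(11, 1), (14, 1), (25, 1)]), (1, [(8, 1), (15, 1), (16, 1), (26, 1)]),
    (1, [(6, 1), (14, 2), (25, 2)]), (1, [(0, 1), (4, 2), (15, 1), (19, 1)]),
    (1, [(4, 1), (8, 1), (16, 1), (31, 1)]), (1, [(8, 2), (13, 1), (15, 1), (26, 2)]),
    (1, [(1, 1), (8, 2), (24, 1), (31, 1)]), (1, [(4, 1), (16, 2), (18, 1), (26, 1)]),
    (1, [(4, 1), (14, 2), (25, 2)]), (1, [(10, 3), (14, 1), (19, 2), (34, 1)]),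
    (1, [(14, 2), (15, 1), (17, 2), (22, 1)]), (1, [(11, 1), (14, 3), (25, 2)]),
    (1, [(0, 2), (4, 3), (23, 1), (36, 1)]), (1, [(8, 1), (15, 4), (21, 1), (24, 2)]),
    (1, [(0, 2), (4, 1), (14, 2), (40, 1)]), (1, [(6, 2), (8, 3), (22, 1), (31, 2)]),
    (1, [(13, 2), (15, 4), (21, 1), (25, 1)]), (1, [(8, 3), (10, 2), (28, 1), (31, 3)]),
    (1, [(13, 1), (14, 5), (21, 1), (25, 2)]), (1, [(0, 3), (6, 5), (8, 4), (25, 1)]),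
    (1, [(1, 1), (13, 1), (27, 3), (31, 3)]), (1, [(4, 3), (15, 1), (19, 4), (31, 2)]),
    (1, [(8, 3), (10, 5), (17, 1), (34, 3)]), (1, [(2, 1), (11, 4), (18, 3), (34, 2)]),
    (1, [(0, 4), (3, 1), (5, 5), (11, 4), (15, 1)]), (1, [(15, 6), (17, 4), (24, 1)]),
    (1, [(0, 2), (4, 4), (27, 3), (31, 2)]), (1, [(15, 7), (17, 3), (19, 2), (24, 2)]),
    (1, [(0, 3), (10, 3), (15, 5), (42, 1)]), (1, [(10, 2), (15, 5), (19, 4), (23, 3)]),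
    (1, [(3, 1), (14, 8), (23, 1), (25, 5)]), (1, [(15, 9), (17, 4), (21, 1), (24, 2)]),
    (1, [(0, 5), (6, 8), (8, 6), (15, 1), (18, 1)]), (1, [(4, 2), (16, 1), (27, 5), (31, 5)]),
    (1, [(14, 4), (15, 6), (17, 7), (31, 1)]), (1, [(0, 6), (10, 6), (15, 4), (30, 3)]),
    (1, [(14, 3), (15, 1), (27, 6), (31, 5)]), (1, [(0, 8), (4, 9), (16, 1), (18, 5), (33, 3)]),
    (1, [(0, 6), (5, 12), (13, 5), (14, 7), (23, 1)]),
    (1, [(0, 11), (1, 9), (4, 7), (7, 4), (10, 7)]),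
    (1, [(11, 7), (14, 4), (18, 11), (20, 2), (34, 5)]),
    (1, [(0, 12), (1, 16), (4, 9), (14, 3), (18, 5)])],
  [
    (1, [(15, 3), (22, 1), (24, 1), (28, 1)]), (1, [(1, 1), (14, 1), (25, 1)]),
    (2, [(0, 1), (2, 1), (5, 2), (19, 1)]), (2, [(0, 1), (2, 2), (6, 1), (24, 1)]),
    (2, [(7, 1), (14, 1), (15, 1), (17, 1)]), (1, [(11, 1), (15, 1), (18, 1), (21, 1)]),
    (2, [(6, 1), (10, 1), (14, 1), (19, 3)]), (1, [(0, 1), (5, 3), (16, 1)]),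
    (1, [(0, 1), (2, 2), (13, 1), (18, 1)]), (1, [(5, 1), (11, 2), (25, 1), (26, 1)]),
    (1, [(9, 1), (14, 1), (15, 1), (22, 1)]), (1, [(7, 1), (11, 1), (22, 1)]),
    (1, [(8, 1), (11, 1), (21, 1)]), (1, [(11, 1), (15, 2), (17, 2)]),
    (1, [(2, 1), (14, 1), (16, 1), (25, 1)]), (1, [(8, 1), (13, 1), (15, 2), (21, 1)]),
    (1, [(0, 1), (4, 2), (19, 1), (27, 1)]), (1, [(4, 1), (8, 2), (19, 1), (23, 3)]),
    (1, [(3, 1), (8, 3), (23, 2), (31, 1)]), (1, [(4, 1), (18, 2), (34, 1), (36, 1)]),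
    (1, [(7, 3), (18, 1), (24, 2)]), (1, [(11, 1), (15, 3), (17, 4), (21, 1)]),
    (1, [(5, 1), (15, 4), (17, 2), (24, 1)]), (1, [(7, 1), (22, 3), (29, 1), (31, 1)]),
    (1, [(3, 1), (16, 4), (18, 2), (21, 1)]), (1, [(14, 2), (18, 4), (34, 1), (35, 1)]),
    (1, [(0, 3), (2, 1), (6, 3), (27, 3)]), (1, [(3, 1), (5, 1), (14, 4), (25, 3)]),
    (1, [(8, 4), (9, 1), (19, 1), (23, 4)]), (1, [(7, 2), (14, 1), (16, 1), (17, 3)]),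
    (1, [(7, 4), (16, 1), (18, 2), (24, 2)]), (1, [(6, 1), (14, 5), (25, 3), (28, 1)]),
    (1, [(8, 4), (19, 1), (23, 4), (28, 1)]), (1, [(3, 1), (10, 2), (15, 1), (19, 6)]),
    (1, [(0, 2), (5, 7), (16, 4), (24, 1)]), (1, [(15, 4), (17, 4), (19, 1), (37, 1)]),
    (1, [(2, 1), (8, 6), (23, 5), (24, 1)]), (1, [(15, 1), (24, 1), (27, 5), (31, 2)]),
    (1, [(4, 2), (14, 4), (25, 5), (30, 1)]), (1, [(7, 2), (14, 1), (15, 5), (17, 8)]),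
    (1, [(14, 1), (15, 7), (17, 8), (28, 1)]), (1, [(13, 1), (27, 7), (31, 2), (34, 1)]),
    (1, [(8, 10), (9, 2), (23, 5), (24, 2), (26, 1)]), (1, [(15, 7), (17, 8), (19, 2), (39, 1)]),
    (1, [(0, 1), (6, 1), (27, 10), (31, 4)]), (1, [(1, 2), (9, 2), (14, 9), (25, 7), (27, 3)])],
  [
    (1, [(7, 2), (10, 1), (24, 1)]), (1, [(1, 1)]), (1, [(9, 1)]), (1, [(10, 1)]), (1, [(5, 1)]),
    (1, [(1, 1), (17, 1)]), (1, [(4, 1)]), (2, [(1, 1), (9, 2), (19, 1)]), (1, [(28, 1)]),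
    (1, [(1, 1), (13, 1)]), (1, [(27, 1)]), (1, [(2, 1)]), (1, [(3, 1)]), (1, [(1, 1), (8, 1)]),
    (2, [(2, 1), (5, 1), (9, 1), (15, 1)]), (1, [(2, 1), (9, 1), (22, 1)]),
    (1, [(1, 1), (7, 1)]), (1, [(36, 1)]), (1, [(1, 1), (8, 1), (17, 2)]),
    (1, [(1, 2), (19, 1)]), (1, [(1, 1), (6, 1)]), (1, [(1, 1), (6, 1), (16, 1), (17, 1)]),
    (1, [(1, 1), (19, 1), (27, 1)]), (1, [(5, 1), (7, 1), (13, 2)]),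
    (1, [(1, 1), (8, 1), (11, 1)]), (1, [(8, 1), (17, 1), (37, 1)]), (1, [(22, 2), (29, 1)]),
    (1, [(40, 1)]), (1, [(1, 1), (37, 1)]), (1, [(12, 1)]), (1, [(1, 1), (20, 1)]),
    (1, [(0, 1), (5, 1), (10, 2), (30, 1)]), (1, [(1, 1), (35, 1)]), (1, [(29, 1)]),
    (1, [(0, 1), (2, 1), (10, 2), (33, 1)]), (1, [(1, 3), (11, 1)]), (1, [(1, 1), (39, 1)]),
    (1, [(1, 1), (38, 1)]), (1, [(1, 2), (32, 1)]), (1, [(1, 1), (42, 1)]),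
    (1, [(1, 1), (44, 1)]), (1, [(1, 3), (30, 1)]), (1, [(1, 2), (41, 1)]),
    (1, [(1, 4), (33, 1)]), (1, [(1, 2), (45, 1)]), (1, [(1, 3), (43, 1)])]]

/-- Certificates that `(-1) ^ k • T B ^ k` maps the flip of each generator into the cone, for
`1 ≤ k ≤ 6`. -/
def certificatesFlip : List (List (ℕ × List (ℕ × ℕ))) := [
  [
    (1, [(0, 2), (4, 2), (13, 1), (21, 1)]), (1, [(0, 1), (1, 1)]),
    (2, [(0, 1), (5, 1), (21, 1)]), (3, [(0, 1), (15, 1), (18, 1), (22, 1)]),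
    (3, [(0, 1), (17, 1), (23, 2)]), (1, [(0, 1), (2, 1), (23, 1)]),
    (2, [(0, 1), (16, 1), (22, 1)]), (1, [(0, 1), (4, 1), (21, 1)]),
    (2, [(10, 1), (26, 2), (34, 1)]), (2, [(0, 2), (7, 1), (8, 1), (14, 1), (23, 1)]),
    (1, [(0, 1), (4, 1), (23, 1)]), (3, [(0, 2), (1, 1), (24, 2)]),
    (2, [(0, 1), (19, 1), (25, 1)]), (1, [(0, 1), (11, 1), (23, 1)]),
    (1, [(0, 1), (5, 1), (24, 1)]), (1, [(0, 2), (1, 1), (3, 1), (17, 1)]),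
    (2, [(0, 1), (7, 1), (24, 2), (31, 1)]), (1, [(0, 2), (5, 1), (6, 1), (14, 1)]),
    (1, [(0, 3), (3, 1), (4, 2), (9, 1)]), (1, [(0, 1), (1, 1), (10, 1), (34, 1)]),
    (2, [(0, 3), (7, 1), (16, 1), (28, 1)]), (1, [(0, 2), (7, 2), (11, 1), (23, 1)]),
    (1, [(1, 1), (22, 1), (31, 2)]), (1, [(0, 1), (14, 2), (23, 1), (25, 1)]),
    (1, [(0, 2), (3, 1), (16, 2)]), (1, [(0, 4), (3, 1), (4, 2), (20, 1)]),
    (1, [(0, 3), (3, 1), (5, 2), (16, 2)]), (1, [(0, 2), (10, 1), (20, 1), (31, 1)]),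
    (1, [(0, 3), (1, 1), (15, 1), (20, 1)]), (7, [(0, 9), (7, 1), (19, 10), (24, 3)]),
    (1, [(0, 2), (1, 1), (16, 1), (21, 1)]), (1, [(11, 1), (16, 1), (25, 2), (31, 2)]),
    (1, [(0, 2), (4, 1), (28, 1), (34, 1)]), (2, [(0, 3), (1, 1), (16, 1), (19, 3), (34, 1)]),
    (1, [(0, 3), (2, 3), (22, 1), (24, 2)]), (1, [(0, 3), (11, 1), (14, 1), (28, 1)]),
    (1, [(0, 4), (2, 1), (6, 3), (19, 1)]), (1, [(0, 4), (10, 1), (14, 1), (33, 1)]),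
    (1, [(0, 4), (9, 1), (14, 1), (35, 1)]), (1, [(0, 2), (19, 2), (20, 1), (31, 2)]),
    (1, [(0, 3), (14, 3), (26, 2), (28, 1)]), (1, [(0, 4), (14, 2), (21, 1), (37, 1)]),
    (1, [(0, 6), (12, 1), (19, 2), (29, 1)]), (1, [(0, 5), (1, 5), (19, 1), (34, 1)]),
    (1, [(0, 8), (20, 1), (22, 1), (29, 2)]), (1, [(0, 8), (11, 2), (17, 1), (20, 3)])],
  [
    (1, [(0, 1), (22, 3), (29, 1), (31, 1)]), (1, [(10, 1), (19, 1), (31, 1)]),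
    (1, [(13, 1), (26, 1)]), (2, [(0, 2), (13, 1), (32, 1)]), (1, [(0, 1), (1, 1), (13, 1)]),
    (1, [(0, 1), (10, 2), (16, 1), (21, 1)]), (1, [(0, 1), (2, 1), (15, 1), (24, 1)]),
    (1, [(9, 1), (13, 1), (22, 1), (31, 1)]), (1, [(0, 1), (6, 2), (22, 2)]),
    (1, [(0, 2), (4, 3), (17, 1), (21, 1)]), (1, [(0, 1), (11, 1), (15, 1), (17, 2)]),
    (1, [(0, 1), (6, 1), (14, 1), (22, 1)]), (1, [(7, 1), (24, 1), (31, 1)]),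
    (1, [(0, 1), (9, 1), (14, 2), (22, 2)]), (1, [(0, 2), (3, 1), (11, 2), (17, 1)]),
    (1, [(0, 1), (13, 3), (15, 1), (21, 1)]), (1, [(0, 2), (3, 2), (16, 2), (22, 1)]),
    (1, [(18, 1), (22, 1), (31, 2), (36, 1)]), (1, [(1, 1), (6, 1), (22, 4), (34, 1)]),
    (1, [(0, 1), (8, 2), (11, 1), (23, 4)]), (1, [(0, 3), (3, 2), (15, 1), (37, 1)]),
    (1, [(8, 3), (23, 5), (34, 1)]), (1, [(0, 1), (22, 4), (29, 1), (31, 1)]),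
    (1, [(0, 2), (7, 3), (13, 3), (23, 2)]), (1, [(0, 1), (11, 1), (15, 3), (17, 3), (31, 1)]),
    (1, [(0, 4), (5, 5), (6, 1), (13, 4)]), (1, [(10, 2), (19, 3), (27, 1), (31, 3)]),
    (1, [(0, 4), (10, 5), (19, 1), (33, 1)]), (1, [(0, 2), (10, 6), (28, 1), (34, 2)]),
    (1, [(11, 1), (17, 1), (27, 1), (31, 3)]), (1, [(1, 2), (6, 1), (22, 3), (31, 3)]),
    (1, [(10, 3), (16, 1), (19, 4), (31, 3)]), (1, [(10, 1), (14, 3), (22, 3), (26, 4)]),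
    (1, [(6, 1), (22, 1), (27, 2), (31, 4)]), (1, [(11, 1), (14, 1), (15, 2), (17, 5), (31, 3)]),
    (1, [(10, 5), (16, 1), (18, 2), (34, 4)]), (1, [(0, 7), (10, 6), (12, 1), (41, 1)]),
    (1, [(0, 6), (10, 5), (15, 3), (35, 2)]), (1, [(6, 1), (22, 6), (29, 1), (31, 4)]),
    (1, [(0, 3), (4, 6), (17, 6), (23, 1), (31, 3)]), (1, [(0, 10), (1, 10), (3, 1), (10, 7)]),
    (1, [(0, 8), (3, 8), (5, 1), (16, 7), (25, 2)]),
    (1, [(0, 2), (4, 5), (15, 2), (17, 8), (31, 5)]),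
    (1, [(3, 5), (16, 2), (22, 8), (31, 3), (34, 3)]),
    (1, [(12, 2), (22, 11), (31, 7), (33, 1)]), (1, [(0, 11), (1, 13), (10, 10), (31, 3)])],
  [
    (1, [(0, 1), (14, 3), (15, 1), (17, 4)]), (1, [(0, 1), (11, 1), (23, 1), (27, 1)]),
    (2, [(0, 1), (10, 1), (13, 2), (16, 1)]), (1, [(5, 1), (13, 1), (31, 1)]),
    (1, [(8, 1), (13, 1), (31, 1)]), (1, [(14, 2), (24, 1), (25, 1)]),
    (1, [(0, 1), (6, 1), (15, 2), (17, 2)]), (1, [(0, 1), (4, 1), (13, 2), (19, 1)]),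
    (1, [(0, 1), (7, 1), (13, 2), (16, 1)]), (1, [(11, 1), (15, 1), (17, 3), (31, 1)]),
    (1, [(10, 1), (14, 1), (19, 2), (31, 1)]), (1, [(0, 2), (4, 3), (17, 1), (19, 1)]),
    (1, [(15, 1), (16, 1), (22, 1), (23, 2)]), (1, [(8, 2), (24, 1), (27, 1), (31, 2)]),
    (1, [(0, 1), (14, 3), (17, 2), (18, 1)]), (1, [(0, 2), (11, 2), (12, 1), (22, 2)]),
    (1, [(0, 3), (4, 3), (17, 1), (36, 1)]), (1, [(0, 3), (4, 3), (24, 1), (40, 1)]),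
    (1, [(0, 2), (3, 2), (11, 1), (16, 2), (19, 2)]), (1, [(0, 3), (4, 2), (13, 2), (40, 1)]),
    (1, [(13, 1), (16, 3), (18, 2), (26, 2)]), (1, [(14, 3), (17, 5), (22, 1), (31, 1)]),
    (1, [(0, 2), (10, 1), (14, 1), (31, 1), (36, 2)]), (1, [(10, 3), (14, 1), (19, 4), (31, 2)]),
    (1, [(4, 2), (20, 1), (22, 5), (34, 2)]), (1, [(1, 1), (8, 4), (24, 3), (31, 2)]),
    (1, [(0, 2), (7, 4), (13, 5), (23, 3)]), (1, [(0, 2), (5, 1), (11, 6), (25, 2), (26, 1)]),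
    (1, [(14, 5), (17, 1), (24, 2), (25, 3)]), (1, [(0, 5), (1, 2), (10, 5), (38, 1)]),
    (1, [(0, 2), (10, 6), (16, 2), (19, 3), (34, 1)]), (1, [(4, 2), (11, 5), (25, 4), (31, 3)]),
    (1, [(11, 5), (13, 2), (25, 4), (31, 2)]), (1, [(11, 1), (15, 6), (24, 4), (25, 3)]),
    (1, [(0, 4), (4, 5), (14, 3), (17, 7)]), (1, [(0, 6), (10, 6), (11, 4), (28, 3)]),
    (1, [(0, 3), (4, 1), (8, 1), (14, 6), (17, 8)]), (1, [(15, 8), (19, 3), (24, 5), (25, 2)]),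
    (1, [(0, 4), (4, 1), (11, 5), (15, 4), (17, 8)]), (1, [(15, 7), (19, 4), (22, 3), (24, 5)]),
    (1, [(9, 1), (11, 4), (22, 10), (29, 1), (34, 3)]),
    (1, [(0, 10), (10, 9), (37, 1), (38, 3)]),
    (1, [(13, 2), (14, 11), (24, 3), (25, 8), (26, 1)]),
    (1, [(13, 1), (16, 13), (18, 6), (25, 1), (26, 6)]),
    (1, [(0, 9), (4, 15), (17, 6), (19, 7), (24, 3)]),
    (1, [(0, 11), (1, 16), (10, 6), (16, 5), (22, 6)])],
  [
    (1, [(8, 2), (10, 3), (13, 1), (34, 2)]), (1, [(15, 2), (19, 1), (24, 1)]),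
    (3, [(0, 2), (8, 2), (11, 3), (15, 1)]), (1, [(14, 1), (17, 1), (22, 1)]),
    (1, [(0, 1), (6, 1), (8, 2), (23, 1)]), (1, [(0, 1), (2, 1), (13, 2), (15, 1)]),
    (1, [(8, 1), (16, 1), (19, 1), (23, 2)]), (1, [(0, 1), (14, 2), (27, 1)]),
    (1, [(8, 2), (14, 1), (23, 1), (31, 1)]), (1, [(8, 1), (15, 2), (24, 2)]),
    (1, [(10, 2), (15, 1), (19, 2), (31, 1)]), (1, [(10, 2), (15, 1), (19, 2), (34, 1)]),
    (1, [(0, 1), (14, 1), (22, 1), (36, 1)]), (1, [(0, 3), (4, 4), (25, 1), (35, 1)]),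
    (1, [(0, 1), (1, 2), (14, 3), (25, 2)]), (1, [(0, 3), (8, 2), (10, 2), (29, 1)]),
    (1, [(8, 3), (11, 1), (23, 3), (34, 1)]), (1, [(0, 3), (6, 4), (8, 3), (10, 1)]),
    (1, [(3, 1), (7, 1), (14, 2), (22, 3), (31, 1)]), (1, [(11, 1), (14, 4), (25, 2), (26, 1)]),
    (1, [(0, 1), (5, 2), (16, 4), (23, 1)]), (1, [(11, 1), (14, 4), (24, 1), (25, 2)]),
    (1, [(0, 4), (4, 6), (25, 1), (35, 1)]), (1, [(15, 5), (17, 2), (19, 1), (24, 2)]),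
    (1, [(6, 1), (14, 4), (21, 2), (22, 4)]), (1, [(0, 4), (4, 7), (24, 1), (28, 1)]),
    (1, [(14, 2), (22, 5), (29, 1), (34, 1)]), (1, [(0, 5), (1, 5), (4, 5), (22, 1)]),
    (1, [(0, 1), (14, 5), (15, 1), (17, 4)]), (1, [(8, 2), (16, 5), (18, 1), (26, 3)]),
    (1, [(0, 5), (4, 5), (16, 1), (44, 1)]), (1, [(13, 2), (14, 7), (21, 1), (25, 4)]),
    (1, [(0, 1), (14, 7), (17, 3), (19, 1), (25, 1)]), (1, [(14, 1), (15, 5), (19, 4), (24, 3)]),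
    (1, [(0, 4), (7, 5), (12, 1), (13, 7)]), (1, [(0, 2), (2, 1), (14, 7), (17, 7)]),
    (1, [(14, 9), (21, 2), (22, 3), (23, 1), (25, 2)]),
    (1, [(8, 1), (15, 9), (19, 2), (21, 1), (24, 5)]),
    (1, [(0, 8), (1, 7), (4, 8), (13, 1), (19, 3)]),
    (1, [(0, 6), (5, 8), (11, 9), (13, 1), (31, 1)]), (1, [(0, 9), (2, 1), (4, 11), (37, 3)]),
    (1, [(0, 2), (15, 11), (19, 3), (24, 4), (37, 2)]),
    (1, [(0, 4), (2, 2), (4, 1), (14, 11), (17, 10)]),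
    (1, [(0, 8), (5, 7), (11, 15), (18, 2), (21, 2)]),
    (1, [(0, 14), (1, 12), (4, 11), (13, 2), (36, 2)]),
    (1, [(0, 11), (2, 14), (6, 1), (13, 17), (34, 1)])],
  [
    (1, [(0, 2), (2, 2), (5, 2), (13, 3)]), (1, [(0, 1), (6, 1), (15, 1), (27, 1)]),
    (1, [(8, 1), (15, 1), (26, 1)]), (1, [(14, 1), (19, 1)]),
    (1, [(0, 1), (3, 1), (4, 1), (19, 2)]), (1, [(8, 1), (15, 1), (19, 1), (23, 1)]),
    (1, [(11, 1), (27, 1), (31, 1)]), (1, [(2, 1), (11, 1), (18, 2), (34, 1)]),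
    (1, [(8, 2), (11, 1), (18, 1), (26, 2)]), (1, [(13, 1), (15, 2), (19, 1)]),
    (1, [(14, 1), (15, 1), (17, 2), (19, 1)]), (1, [(11, 1), (15, 2), (17, 2), (26, 1)]),
    (1, [(0, 2), (1, 3), (4, 1), (15, 1)]), (1, [(8, 2), (11, 1), (19, 1), (23, 3)]),
    (1, [(0, 2), (3, 2), (4, 2), (19, 3)]), (1, [(7, 1), (12, 1), (22, 3), (34, 1)]),
    (1, [(7, 1), (8, 2), (16, 1), (23, 4)]), (1, [(15, 3), (16, 1), (17, 3)]),
    (1, [(7, 1), (16, 3), (18, 2), (21, 1)]), (1, [(3, 1), (14, 4), (25, 3)]),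
    (1, [(3, 1), (8, 3), (13, 1), (31, 2)]), (1, [(8, 2), (15, 2), (16, 1), (23, 2)]),
    (1, [(0, 2), (5, 5), (13, 2), (16, 2)]), (1, [(1, 1), (14, 4), (17, 1), (25, 2)]),
    (1, [(8, 3), (11, 1), (16, 1), (23, 4)]), (1, [(7, 2), (9, 1), (14, 2), (22, 4)]),
    (1, [(5, 1), (14, 5), (17, 1), (25, 2)]), (1, [(0, 1), (4, 1), (27, 4), (31, 2)]),
    (1, [(2, 2), (14, 2), (15, 1), (22, 4), (26, 1)]), (1, [(4, 1), (8, 2), (10, 5), (34, 3)]),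
    (1, [(4, 4), (13, 1), (18, 3), (27, 1), (34, 3)]), (1, [(0, 3), (3, 2), (7, 5), (13, 5)]),
    (1, [(0, 5), (2, 6), (10, 4), (13, 3)]), (1, [(14, 4), (18, 3), (31, 2), (40, 1)]),
    (1, [(6, 2), (8, 6), (23, 3), (31, 2)]), (1, [(8, 3), (13, 4), (15, 4), (26, 3)]),
    (1, [(1, 3), (15, 8), (24, 3), (25, 3)]), (1, [(8, 7), (11, 2), (23, 7), (31, 1)]),
    (1, [(15, 11), (17, 6), (21, 1), (24, 2)]), (1, [(0, 3), (3, 1), (15, 7), (18, 3), (37, 3)]),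
    (1, [(0, 2), (7, 4), (11, 8), (18, 6), (26, 3)]),
    (1, [(0, 9), (1, 12), (4, 8), (18, 3), (22, 1)]), (1, [(8, 10), (14, 3), (23, 10), (31, 1)]),
    (1, [(15, 16), (17, 7), (21, 1), (24, 3)]),
    (1, [(15, 17), (17, 7), (24, 4), (25, 1), (28, 1)]),
    (1, [(14, 4), (15, 14), (17, 14), (26, 1), (31, 1)])],
  [
    (1, [(1, 2), (14, 1), (25, 1)]), (1, [(1, 1), (14, 1), (25, 1)]), (1, [(26, 1), (27, 1)]),
    (2, [(2, 1), (4, 1), (18, 1), (31, 1)]), (1, [(9, 1), (14, 1), (22, 1)]),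
    (1, [(1, 1), (8, 1), (26, 1)]), (1, [(5, 1), (14, 1), (22, 1)]),
    (1, [(2, 1), (13, 1), (21, 1), (22, 1)]), (1, [(0, 1), (1, 3), (17, 1)]),
    (1, [(7, 1), (8, 1), (23, 1)]), (1, [(7, 1), (11, 1), (23, 1)]),
    (1, [(9, 1), (16, 2), (18, 1)]), (1, [(3, 1), (14, 2), (25, 2)]),
    (1, [(1, 1), (13, 1), (15, 1), (19, 1)]), (1, [(0, 1), (1, 3), (10, 1), (22, 1)]),
    (1, [(3, 1), (16, 2), (18, 1), (21, 1)]), (1, [(6, 1), (11, 1), (18, 1), (19, 2)]),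
    (1, [(15, 1), (16, 1), (28, 1)]), (1, [(0, 1), (1, 1), (12, 1), (19, 1)]),
    (1, [(8, 1), (16, 1), (23, 1), (28, 1)]), (1, [(7, 1), (15, 2), (17, 3)]),
    (1, [(5, 2), (15, 1), (19, 2)]), (1, [(11, 1), (14, 1), (21, 1), (27, 1)]),
    (1, [(0, 1), (5, 3), (11, 2)]), (1, [(2, 1), (5, 1), (16, 2), (22, 1)]),
    (1, [(2, 1), (5, 1), (16, 2), (21, 1)]), (1, [(2, 1), (27, 2), (31, 1)]),
    (1, [(0, 2), (1, 5), (27, 1)]), (1, [(2, 1), (17, 1), (27, 2), (34, 1)]),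
    (1, [(8, 4), (10, 2), (24, 1), (26, 2)]), (1, [(7, 2), (22, 4), (23, 1), (33, 1)]),
    (1, [(5, 2), (14, 2), (15, 1), (17, 3)]), (1, [(3, 2), (15, 1), (18, 1), (19, 6)]),
    (1, [(14, 3), (18, 1), (25, 2), (40, 1)]), (1, [(1, 3), (4, 1), (14, 2), (25, 3)]),
    (1, [(8, 4), (16, 1), (23, 3), (28, 1)]), (1, [(8, 2), (19, 2), (23, 3), (38, 1)]),
    (1, [(0, 1), (2, 1), (22, 4), (30, 2)]), (1, [(0, 3), (4, 4), (17, 2), (40, 2)]),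
    (1, [(7, 7), (13, 1), (18, 2), (24, 4)]), (1, [(14, 4), (25, 4), (43, 1)]),
    (1, [(15, 5), (17, 6), (19, 2), (38, 1)]), (1, [(2, 3), (22, 7), (34, 1), (43, 1)]),
    (1, [(1, 4), (14, 6), (25, 6), (40, 1)]), (1, [(6, 1), (13, 1), (27, 8), (34, 3)]),
    (1, [(3, 3), (10, 4), (15, 3), (19, 14)])]]

/-- The orbit pairing `j ↦ φ (B ^ j e)` of the transvection `T x = x + φ x • e`. -/
def transvCoeff (j : ZMod 7) : ℤ := [0, -4, 7, -8, 8, -7, 4].getD j.val 0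

/-- The entries of the `i`-th generator of the cone. -/
def rayEntry (i : ℕ) (j : ZMod 7) : ℤ := (rays.getD i []).getD j.val 0

/-- The sign of the coordinate `a k` for `a` in the cone. -/
def sgn (k : ZMod 7) : ℤ := (-1) ^ k.val

/-- The certificate `(d, c)` expresses `d • v` as the combination `c` of the generators. -/
def IsCertificate (p : ℕ × List (ℕ × ℕ)) (v : ZMod 7 → ℤ) : Prop :=
  0 < p.1 ∧ ∀ j, (p.1 : ℤ) * v j = (p.2.map fun q => (q.2 : ℤ) * rayEntry q.1 j).sum

instance (p : ℕ × List (ℕ × ℕ)) (v : ZMod 7 → ℤ) : Decidable (IsCertificate p v) :=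
  inferInstanceAs (Decidable (_ ∧ _))

/-- The `i`-th certificate of the `k`-th table. -/
def entry (l : List (List (ℕ × List (ℕ × ℕ)))) (k : ZMod 7) (i : ℕ) : ℕ × List (ℕ × ℕ) :=
  (l.getD (k.val - 1) []).getD i (0, [])

theorem isCertificate_entry (k : ZMod 7) (hk : k ≠ 0) (i : Fin 46) :
    IsCertificate (entry certificates k i)
      fun j => sgn k * (rayEntry i (j + k) + rayEntry i k * transvCoeff j) := by
  revert i k
  decide +kernel

theorem isCertificate_entry_flip (k : ZMod 7) (hk : k ≠ 0) (i : Fin 46) :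
    IsCertificate (entry certificatesFlip k i)
      fun j => sgn k * (-rayEntry i (-(j + k)) + -rayEntry i (-k) * transvCoeff j) := by
  revert i k
  decide +kernel

/-- The rational vector of the `i`-th generator. -/
def ray (i : Fin 46) (j : ZMod 7) : ℚ := rayEntry i j

/-- The shift by `k`, the action of `B ^ k` in the coordinates `j ↦ φ (B ^ j x)`. -/
def shift (k : ZMod 7) : (ZMod 7 → ℚ) →ₗ[ℚ] ZMod 7 → ℚ := LinearMap.funLeft ℚ ℚ (· + k)

/-- The action of `T ^ n` in the coordinates `j ↦ φ (B ^ j x)`. -/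
def transv (n : ℤ) : (ZMod 7 → ℚ) →ₗ[ℚ] ZMod 7 → ℚ where
  toFun a j := a j + n * (a 0 * transvCoeff j)
  map_add' a b := by ext j; simp only [Pi.add_apply]; ring
  map_smul' c a := by ext j; simp only [Pi.smul_apply, smul_eq_mul, RingHom.id_apply]; ring

/-- The involution inverting both `B` and `T`. -/
def flip : (ZMod 7 → ℚ) →ₗ[ℚ] ZMod 7 → ℚ := -LinearMap.funLeft ℚ ℚ (- ·)

/-- A functional fixed by `T * B⁻¹` on vectors with vanishing coordinate sum. -/
def kappa : (ZMod 7 → ℚ) →ₗ[ℚ] ℚ :=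
  (-3 : ℚ) • LinearMap.proj 0 - (2 : ℚ) • LinearMap.proj 1 - LinearMap.proj 2 + LinearMap.proj 4 +
    (2 : ℚ) • LinearMap.proj 5 + (3 : ℚ) • LinearMap.proj 6

@[simp] theorem shift_apply (k : ZMod 7) (a : ZMod 7 → ℚ) (j : ZMod 7) :
    shift k a j = a (j + k) := rfl

@[simp] theorem transv_apply (n : ℤ) (a : ZMod 7 → ℚ) (j : ZMod 7) :
    transv n a j = a j + n * (a 0 * transvCoeff j) := rfl

@[simp] theorem flip_apply (a : ZMod 7 → ℚ) (j : ZMod 7) : flip a j = -a (-j) := rfl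

theorem flip_flip (a : ZMod 7 → ℚ) : flip (flip a) = a := by ext j; simp

theorem kappa_apply (a : ZMod 7 → ℚ) :
    kappa a = -3 * a 0 - 2 * a 1 - a 2 + a 4 + 2 * a 5 + 3 * a 6 := by
  simp [kappa]

theorem transvCoeff_neg (j : ZMod 7) : transvCoeff (-j) = -transvCoeff j := by
  revert j; decide

theorem transvCoeff_zero : transvCoeff 0 = 0 := by decide

theorem flip_transv (n : ℤ) (a : ZMod 7 → ℚ) : flip (transv n a) = transv (-n) (flip a) := by
  ext j
  simp [transvCoeff_neg, add_comm]

theorem flip_shift (k : ZMod 7) (a : ZMod 7 → ℚ) : flip (shift k a) = shift (-k) (flip a) := by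
  ext j
  simp [add_comm]

theorem sgn_neg {k : ZMod 7} (hk : k ≠ 0) : sgn (-k) = -sgn k := by
  revert k; decide

/-- The polyhedral cone spanned by the generators. -/
def cone : Submodule ℚ≥0 (ZMod 7 → ℚ) := Submodule.span ℚ≥0 (Set.range ray)

theorem smul_mem_cone {c : ℚ} (hc : 0 ≤ c) {x : ZMod 7 → ℚ} (hx : x ∈ cone) : c • x ∈ cone :=
  cone.smul_mem (⟨c, hc⟩ : ℚ≥0) hx

theorem ray_mem_cone (i : Fin 46) : ray i ∈ cone := Submodule.subset_span ⟨i, rfl⟩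

theorem map_mem_cone (f : (ZMod 7 → ℚ) →ₗ[ℚ] ZMod 7 → ℚ) (hf : ∀ i, f (ray i) ∈ cone)
    {x : ZMod 7 → ℚ} (hx : x ∈ cone) : f x ∈ cone := by
  induction hx using Submodule.span_induction with
  | mem x h => obtain ⟨i, rfl⟩ := h; exact hf i
  | zero => simp
  | add x y _ _ h₁ h₂ => rw [map_add]; exact add_mem h₁ h₂
  | smul c x _ h =>
    rw [show f (c • x) = (c : ℚ) • f x from f.map_smul (c : ℚ) x]
    exact smul_mem_cone c.2 h

theorem nonneg_of_mem_cone (f : (ZMod 7 → ℚ) →ₗ[ℚ] ℚ) (hf : ∀ i, 0 ≤ f (ray i))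
    {x : ZMod 7 → ℚ} (hx : x ∈ cone) : 0 ≤ f x := by
  induction hx using Submodule.span_induction with
  | mem x h => obtain ⟨i, rfl⟩ := h; exact hf i
  | zero => simp
  | add x y _ _ h₁ h₂ => rw [map_add]; exact add_nonneg h₁ h₂
  | smul c x _ h =>
    rw [show f (c • x) = (c : ℚ) • f x from f.map_smul (c : ℚ) x]
    exact mul_nonneg c.2 h

theorem IsCertificate.mem_cone {p : ℕ × List (ℕ × ℕ)} {v : ZMod 7 → ℤ} (h : IsCertificate p v)
    (hp : ∀ q ∈ p.2, q.1 < 46) : (fun j => (v j : ℚ)) ∈ cone := by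
  obtain ⟨d, l⟩ := p
  obtain ⟨hd, h⟩ := h
  have key : ∀ l : List (ℕ × ℕ), (∀ q ∈ l, q.1 < 46) →
      (fun j => (((l.map fun q => (q.2 : ℤ) * rayEntry q.1 j).sum : ℤ) : ℚ)) ∈ cone := by
    intro l
    induction l with
    | nil => intro _; exact cone.zero_mem
    | cons q l ih =>
      intro hl
      have := add_mem
        (smul_mem_cone (Nat.cast_nonneg q.2) (ray_mem_cone ⟨q.1, hl q (by simp)⟩))
        (ih fun r hr => hl r (by simp [hr]))
      convert this using 1
      ext j
      simp [ray]
  have := smul_mem_cone (inv_nonneg.2 (Nat.cast_nonneg d)) (key l hp)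
  convert this using 1
  ext j
  have hd' : (d : ℚ) ≠ 0 := by exact_mod_cast hd.ne'
  have hj : (d : ℚ) * v j = (((l.map fun q => (q.2 : ℤ) * rayEntry q.1 j).sum : ℤ) : ℚ) := by
    rw [← h j]
    push_cast
    rfl
  change (v j : ℚ) = (d : ℚ)⁻¹ * (((l.map fun q => (q.2 : ℤ) * rayEntry q.1 j).sum : ℤ) : ℚ)
  rw [← hj, inv_mul_cancel_left₀ hd']

theorem lt_of_mem_entry (k : ZMod 7) (i : Fin 46) :
    (∀ q ∈ (entry certificates k i).2, q.1 < 46) ∧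
      ∀ q ∈ (entry certificatesFlip k i).2, q.1 < 46 := by
  revert i k
  decide +kernel

theorem step_mem_cone {k : ZMod 7} (hk : k ≠ 0) {x : ZMod 7 → ℚ} (hx : x ∈ cone ∨ flip x ∈ cone) :
    (sgn k : ℚ) • transv 1 (shift k x) ∈ cone := by
  rcases hx with hx | hx
  · refine map_mem_cone ((sgn k : ℚ) • transv 1 ∘ₗ shift k) (fun i => ?_) hx
    convert (isCertificate_entry k hk i).mem_cone (lt_of_mem_entry k i).1 using 1
    ext j
    simp [ray]
  · rw [← flip_flip x]
    refine map_mem_cone ((sgn k : ℚ) • transv 1 ∘ₗ shift k ∘ₗ flip) (fun i => ?_) hx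
    convert (isCertificate_entry_flip k hk i).mem_cone (lt_of_mem_entry k i).2 using 1
    ext j
    simp [ray]

/-- The part of the cone on which the ping-pong argument takes place. -/
def core : Set (ZMod 7 → ℚ) := {x | x ∈ cone ∧ 0 < x 0 ∧ 0 < kappa x}

/-- The functional `kappa` on integer vectors. -/
def kappaInt (v : ZMod 7 → ℤ) : ℤ := -3 * v 0 - 2 * v 1 - v 2 + v 4 + 2 * v 5 + 3 * v 6

theorem kappa_intCast (v : ZMod 7 → ℤ) : kappa (fun j => (v j : ℚ)) = kappaInt v := by
  simp [kappa_apply, kappaInt]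

theorem sgn_mul_pos {x : ZMod 7 → ℚ} (hx : x ∈ core) (k : ZMod 7) : 0 < sgn k * x k := by
  have h := nonneg_of_mem_cone (7 • (sgn k : ℚ) • LinearMap.proj k - LinearMap.proj 0) (fun i => ?_)
    hx.1
  · simp at h
    linarith [hx.2.1]
  · have : 0 ≤ 7 * (sgn k * rayEntry i k) - rayEntry i 0 := by revert i k; decide +kernel
    simpa [ray] using (Int.cast_nonneg this : (0 : ℚ) ≤ _)

theorem kappaInt_step_le (k : ZMod 7) (hk : k ≠ 0) (i : Fin 46) :
    0 ≤ 2 * kappaInt (fun j =>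
      sgn k * (rayEntry i (j + k) + rayEntry i k * transvCoeff j)) - kappaInt (rayEntry i) ∧
    0 ≤ 2 * kappaInt (fun j => sgn k *
      (-rayEntry i (-(j + k)) + -rayEntry i (-k) * transvCoeff j)) - kappaInt (rayEntry i) := by
  revert i k
  decide +kernel

theorem step_mem_core {k : ZMod 7} (hk : k ≠ 0) {x : ZMod 7 → ℚ} (hx : x ∈ core ∨ flip x ∈ core) :
    (sgn k : ℚ) • transv 1 (shift k x) ∈ core := by
  have hpos : 0 < sgn k * x k := by
    rcases hx with hx | hx
    · exact sgn_mul_pos hx k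
    · have := sgn_mul_pos hx (-k)
      rw [sgn_neg hk] at this
      simpa using this
  refine ⟨step_mem_cone hk (hx.imp And.left And.left), by simpa [transvCoeff_zero] using hpos, ?_⟩
  rcases hx with hx | hx
  · have h := nonneg_of_mem_cone
      ((2 : ℚ) • kappa ∘ₗ ((sgn k : ℚ) • transv 1 ∘ₗ shift k) - kappa) (fun i => ?_) hx.1
    · simp at h
      simp
      linarith [hx.2.2]
    · have hM : ((sgn k : ℚ) • transv 1 ∘ₗ shift k) (ray i) =
          fun j => ((sgn k * (rayEntry i (j + k) + rayEntry i k * transvCoeff j) : ℤ) : ℚ) := by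
        ext j
        simp [ray]
      have hi := (kappaInt_step_le k hk i).1
      rw [LinearMap.sub_apply, LinearMap.smul_apply, LinearMap.comp_apply, hM, kappa_intCast,
        show kappa (ray i) = kappaInt (rayEntry i) from kappa_intCast _, smul_eq_mul]
      exact_mod_cast hi
  · have h := nonneg_of_mem_cone
      ((2 : ℚ) • kappa ∘ₗ ((sgn k : ℚ) • transv 1 ∘ₗ shift k ∘ₗ flip) - kappa) (fun i => ?_) hx.1
    · simp [flip_flip] at h
      simp
      linarith [hx.2.2]
    · have hM : ((sgn k : ℚ) • transv 1 ∘ₗ shift k ∘ₗ flip) (ray i) =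
          fun j => ((sgn k * (-rayEntry i (-(j + k)) + -rayEntry i (-k) * transvCoeff j) : ℤ) : ℚ) := by
        ext j
        simp [ray]
      have hi := (kappaInt_step_le k hk i).2
      rw [LinearMap.sub_apply, LinearMap.smul_apply, LinearMap.comp_apply, hM, kappa_intCast,
        show kappa (ray i) = kappaInt (rayEntry i) from kappa_intCast _, smul_eq_mul]
      exact_mod_cast hi

theorem transv_mem_core {k : ZMod 7} (hk : k ≠ 0) {x : ZMod 7 → ℚ} (hx : x ∈ core ∨ flip x ∈ core)
    {n : ℤ} (hn : 0 < n) : (sgn k : ℚ) • transv n (shift k x) ∈ core := by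
  have h := step_mem_core hk hx
  have hn' : (0 : ℚ) ≤ n - 1 := by exact_mod_cast Int.sub_nonneg.2 hn
  have hc : 0 ≤ ((n : ℚ) - 1) * (sgn k * x k) :=
    mul_nonneg hn' (by simpa [transvCoeff_zero] using h.2.1.le)
  have heq : (sgn k : ℚ) • transv n (shift k x) =
      (sgn k : ℚ) • transv 1 (shift k x) + (((n : ℚ) - 1) * (sgn k * x k)) • ray 0 := by
    ext j
    have : ray 0 j = transvCoeff j := by
      have : rayEntry 0 j = transvCoeff j := by revert j; decide
      exact congrArg (Int.cast (R := ℚ)) this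
    simp [this]
    ring
  rw [heq]
  refine ⟨add_mem h.1 (smul_mem_cone hc (ray_mem_cone 0)), ?_, ?_⟩
  · have : ray 0 0 = 0 := rfl
    simpa [this] using h.2.1
  · have : 0 ≤ kappa (ray 0) := by
      have : kappa (ray 0) = kappaInt (rayEntry 0) := kappa_intCast _
      rw [this]
      norm_cast
    rw [map_add, map_smul kappa _ (ray 0)]
    have := mul_nonneg hc this
    exact lt_of_lt_of_le h.2.2 (le_add_of_nonneg_right this)

/-- The ping-pong domain of the powers of `T`: the core, its mirror image, and their negatives. -/
def domT : Set (ZMod 7 → ℚ) :=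
  {x | (x ∈ core ∨ flip x ∈ core) ∨ (-x ∈ core ∨ flip (-x) ∈ core)}

/-- The ping-pong domain of the powers of `B`. -/
def domB : Set (ZMod 7 → ℚ) := {y | ∃ k ≠ 0, ∃ x ∈ domT, y = shift k x}

theorem neg_mem_domT {x : ZMod 7 → ℚ} : -x ∈ domT ↔ x ∈ domT := by
  simp only [domT, Set.mem_ofPred_eq, neg_neg]
  exact or_comm

theorem flip_mem_domT {x : ZMod 7 → ℚ} : flip x ∈ domT ↔ x ∈ domT := by
  simp only [domT, Set.mem_ofPred_eq, ← map_neg, flip_flip]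
  tauto

theorem core_subset_domT : core ⊆ domT := fun _ hx => .inl (.inl hx)

theorem mem_domT_of_sgn_smul {k : ZMod 7} {x : ZMod 7 → ℚ} (h : (sgn k : ℚ) • x ∈ domT) :
    x ∈ domT := by
  have : sgn k = 1 ∨ sgn k = -1 := by clear h; revert k; decide
  rcases this with hk | hk
  · simpa [hk] using h
  · rw [← neg_mem_domT]
    simpa [hk] using h

theorem transv_shift_mem_domT {n : ℤ} (hn : n ≠ 0) {k : ZMod 7} (hk : k ≠ 0) {x : ZMod 7 → ℚ}
    (hx : x ∈ domT) : transv n (shift k x) ∈ domT := by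
  wlog hn' : 0 < n generalizing n k x
  · rw [← flip_mem_domT, flip_transv, flip_shift]
    exact this (neg_ne_zero.2 hn) (neg_ne_zero.2 hk) (flip_mem_domT.2 hx) (by omega)
  rcases hx with hx | hx
  · exact mem_domT_of_sgn_smul (core_subset_domT (transv_mem_core hk hx hn'))
  · rw [← neg_mem_domT, ← map_neg, ← map_neg]
    exact mem_domT_of_sgn_smul (core_subset_domT (transv_mem_core hk hx hn'))

theorem transv_mem_domT {n : ℤ} (hn : n ≠ 0) {y : ZMod 7 → ℚ} (hy : y ∈ domB) :
    transv n y ∈ domT := by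
  obtain ⟨k, hk, x, hx, rfl⟩ := hy
  exact transv_shift_mem_domT hn hk hx

theorem shift_mem_domB {k : ZMod 7} (hk : k ≠ 0) {x : ZMod 7 → ℚ} (hx : x ∈ domT) :
    shift k x ∈ domB := ⟨k, hk, x, hx, rfl⟩

theorem signs_of_mem_core {x : ZMod 7 → ℚ} (hx : x ∈ core) :
    0 < x 0 ∧ x 1 < 0 ∧ 0 < x 2 ∧ x 3 < 0 ∧ 0 < x 4 ∧ x 5 < 0 ∧ 0 < x 6 := by
  have h := sgn_mul_pos hx
  have h1 := h 1
  have h2 := h 2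
  have h3 := h 3
  have h4 := h 4
  have h5 := h 5
  have h6 := h 6
  rw [show sgn 1 = -1 by decide] at h1
  rw [show sgn 2 = 1 by decide] at h2
  rw [show sgn 3 = -1 by decide] at h3
  rw [show sgn 4 = 1 by decide] at h4
  rw [show sgn 5 = -1 by decide] at h5
  rw [show sgn 6 = 1 by decide] at h6
  push_cast at *
  refine ⟨hx.2.1, ?_, ?_, ?_, ?_, ?_, ?_⟩ <;> linarith

theorem signs_of_flip_mem_core {x : ZMod 7 → ℚ} (hx : flip x ∈ core) :
    x 0 < 0 ∧ x 1 < 0 ∧ 0 < x 2 ∧ x 3 < 0 ∧ 0 < x 4 ∧ x 5 < 0 ∧ 0 < x 6 := by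
  obtain ⟨h0, h1, h2, h3, h4, h5, h6⟩ := signs_of_mem_core hx
  simp only [flip_apply, neg_zero] at *
  rw [show (-1 : ZMod 7) = 6 by decide] at h1
  rw [show (-2 : ZMod 7) = 5 by decide] at h2
  rw [show (-3 : ZMod 7) = 4 by decide] at h3
  rw [show (-4 : ZMod 7) = 3 by decide] at h4
  rw [show (-5 : ZMod 7) = 2 by decide] at h5
  rw [show (-6 : ZMod 7) = 1 by decide] at h6
  refine ⟨?_, ?_, ?_, ?_, ?_, ?_, ?_⟩ <;> linarith

theorem kappa_shift_one_flip (x : ZMod 7 → ℚ) : kappa (shift 1 (flip x)) = kappa x := by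
  simp only [kappa_apply, shift_apply, flip_apply]
  rw [show -((0 : ZMod 7) + 1) = 6 by decide, show -((1 : ZMod 7) + 1) = 5 by decide,
    show -((2 : ZMod 7) + 1) = 4 by decide, show -((4 : ZMod 7) + 1) = 2 by decide,
    show -((5 : ZMod 7) + 1) = 1 by decide, show -((6 : ZMod 7) + 1) = 0 by decide]
  ring

theorem neg_shift_one_not_mem_core {x : ZMod 7 → ℚ} (hx : flip x ∈ core) :
    -shift 1 x ∉ core := by
  intro h
  have h₁ := h.2.2
  have h₂ := hx.2.2
  rw [← kappa_shift_one_flip, flip_flip] at h₂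
  rw [map_neg] at h₁
  linarith

theorem shift_not_mem_domT {k : ZMod 7} (hk : k ≠ 0) {x : ZMod 7 → ℚ}
    (hx : x ∈ core ∨ flip x ∈ core) : shift k x ∉ domT := by
  intro hy
  have key : ∀ k : ZMod 7, k ≠ 0 → k = 1 ∨ k = 2 ∨ k = 3 ∨ k = 4 ∨ k = 5 ∨ k = 6 := by decide
  have hsx : x 1 < 0 ∧ 0 < x 2 ∧ x 3 < 0 ∧ 0 < x 4 ∧ x 5 < 0 ∧ 0 < x 6 :=
    hx.elim (fun h => (signs_of_mem_core h).2) fun h => (signs_of_flip_mem_core h).2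
  obtain ⟨h1, h2, h3, h4, h5, h6⟩ := hsx
  have hsy : ∀ y : ZMod 7 → ℚ, y ∈ core ∨ flip y ∈ core →
      y 1 < 0 ∧ 0 < y 2 ∧ y 3 < 0 ∧ 0 < y 4 ∧ y 5 < 0 ∧ 0 < y 6 := fun y hy =>
    hy.elim (fun h => (signs_of_mem_core h).2) fun h => (signs_of_flip_mem_core h).2
  rcases key k hk with rfl | rfl | rfl | rfl | rfl | rfl
  · rcases hy with hy | hy <;> obtain ⟨y1, y2, y3, y4, y5, y6⟩ := hsy _ hy
    · have : x 2 < 0 := y1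
      linarith
    · have h0 : 0 < -x 0 := y6
      rcases hx with hx | hx
      · linarith [hx.2.1]
      rcases hy with hy | hy
      · exact neg_shift_one_not_mem_core hx hy
      · have : -x 1 < 0 := (signs_of_flip_mem_core hy).1
        linarith
  · rcases hy with hy | hy <;> obtain ⟨y1, y2, y3, y4, y5, y6⟩ := hsy _ hy
    · have : 0 < x 1 := y6
      linarith
    · have : -x 3 < 0 := y1
      linarith
  · rcases hy with hy | hy <;> obtain ⟨y1, y2, y3, y4, y5, y6⟩ := hsy _ hy
    · have : x 4 < 0 := y1
      linarith
    · have : -x 1 < 0 := y5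
      linarith
  · rcases hy with hy | hy <;> obtain ⟨y1, y2, y3, y4, y5, y6⟩ := hsy _ hy
    · have : 0 < x 1 := y4
      linarith
    · have : -x 5 < 0 := y1
      linarith
  · rcases hy with hy | hy <;> obtain ⟨y1, y2, y3, y4, y5, y6⟩ := hsy _ hy
    · have : x 6 < 0 := y1
      linarith
    · have : -x 1 < 0 := y3
      linarith
  · rcases hy with hy | hy <;> obtain ⟨y1, y2, y3, y4, y5, y6⟩ := hsy _ hy
    · have : 0 < x 1 := y2
      linarith
    · have h0 : -x 0 < 0 := y1
      rcases hx with hx | hx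
      · rcases hy with hy | hy
        · have : 0 < -x 6 := hy.2.1
          linarith
        · refine neg_shift_one_not_mem_core hy ?_
          convert hx
          ext j
          change - -x (j + 1 + 6) = x j
          rw [neg_neg, add_assoc, show (1 : ZMod 7) + 6 = 0 by decide, add_zero]
      · linarith [(signs_of_flip_mem_core hx).1]

theorem disjoint_domT_domB : Disjoint domT domB := by
  rw [Set.disjoint_left]
  rintro _ hy ⟨k, hk, x, hx | hx, rfl⟩
  · exact shift_not_mem_domT hk hx hy
  · rw [← neg_mem_domT, ← map_neg] at hy
    exact shift_not_mem_domT hk hx hy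


/-- The coordinates `j ↦ φ (B ^ j x)` of a vector, where `φ` is the first coordinate. -/
def coords (x : Fin 6 → ℚ) : ZMod 7 → ℚ :=
  (![x 0, -x 5, x 5 - x 4, x 4 - x 3, x 3 - x 2, x 2 - x 1, x 1 - x 0] : Fin 7 → ℚ)

theorem coords_apply (x : Fin 6 → ℚ) : coords x 0 = x 0 ∧ coords x 1 = -x 5 ∧
    coords x 2 = x 5 - x 4 ∧ coords x 3 = x 4 - x 3 ∧ coords x 4 = x 3 - x 2 ∧
    coords x 5 = x 2 - x 1 ∧ coords x 6 = x 1 - x 0 :=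
  ⟨rfl, rfl, rfl, rfl, rfl, rfl, rfl⟩

theorem transv_transv (m n : ℤ) (a : ZMod 7 → ℚ) : transv m (transv n a) = transv (m + n) a := by
  ext j
  simp [transvCoeff_zero]
  ring

theorem transv_zero (a : ZMod 7 → ℚ) : transv 0 a = a := by
  ext j
  simp

section Equivariance

variable {α : Type*} (c : α → ZMod 7 → ℚ) {G : Type*} [Group G] [MulAction G α] {g : G}

include c

theorem map_zpow_smul_eq_transv (hg : ∀ x, c (g • x) = transv 1 (c x)) (n : ℤ) (x : α) :
    c (g ^ n • x) = transv n (c x) := by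
  induction n using Int.induction_on with
  | zero => simp [transv_zero]
  | succ n ih => rw [add_comm, _root_.zpow_add, zpow_one, mul_smul, hg, ih, transv_transv]
  | pred n ih =>
    have h := hg (g ^ (-(n : ℤ) - 1) • x)
    rw [← mul_smul, ← _root_.zpow_one_add, add_sub_cancel, ih] at h
    rw [sub_eq_neg_add, ← transv_transv, h, transv_transv, neg_add_cancel, transv_zero,
      ← sub_eq_neg_add]

theorem map_pow_smul_eq_shift (hg : ∀ x, c (g • x) = shift 1 (c x)) (n : ℕ) (x : α) :
    c (g ^ n • x) = shift n (c x) := by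
  induction n with
  | zero => ext j; simp
  | succ n ih =>
    rw [pow_succ', mul_smul, hg, ih]
    ext j
    simp [add_comm, add_left_comm]

end Equivariance

/-- The family of two types `G` and `H` indexed by `Bool`. -/
abbrev pairFamily (G H : Type) (b : Bool) : Type := cond b G H

instance pairFamily.group (G H : Type) [Group G] [Group H] (b : Bool) : Group (pairFamily G H b) :=
  match b with
  | true => ‹Group G›
  | false => ‹Group H›

theorem coprod_injective_of_ping_pong {G H : Type} {K α : Type*} [Group G] [Group H] [Group K]
    [MulAction K α] (ψ : Monoid.Coprod G H →* K) (X Y : Set α) (hX : X.Nonempty)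
    (hY : Y.Nonempty) (hXY : Disjoint X Y)
    (hG : ∀ g : G, g ≠ 1 → ∀ y ∈ Y, ψ (Monoid.Coprod.inl g) • y ∈ X)
    (hH : ∀ h : H, h ≠ 1 → ∀ x ∈ X, ψ (Monoid.Coprod.inr h) • x ∈ Y)
    (hcard : 3 ≤ Cardinal.mk H) : Function.Injective ψ := by
  let incl : ∀ b, pairFamily G H b →* Monoid.Coprod G H := fun b => match b with
    | true => Monoid.Coprod.inl
    | false => Monoid.Coprod.inr
  let σ : Monoid.Coprod G H →* Monoid.CoprodI (pairFamily G H) :=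
    Monoid.Coprod.lift (Monoid.CoprodI.of (M := pairFamily G H) (i := true))
      (Monoid.CoprodI.of (M := pairFamily G H) (i := false))
  have hσ : (Monoid.CoprodI.lift fun b => ψ.comp (incl b)).comp σ = ψ := by
    refine Monoid.Coprod.hom_ext ?_ ?_
    · ext g
      exact Monoid.CoprodI.lift_of (fun b => ψ.comp (incl b)) (i := true) g
    · ext h
      exact Monoid.CoprodI.lift_of (fun b => ψ.comp (incl b)) (i := false) h
  have hσ' : (Monoid.CoprodI.lift incl).comp σ = MonoidHom.id _ := by
    refine Monoid.Coprod.hom_ext ?_ ?_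
    · ext g
      exact Monoid.CoprodI.lift_of incl (i := true) g
    · ext h
      exact Monoid.CoprodI.lift_of incl (i := false) h
  have hσ_inj : Function.Injective σ :=
    Function.LeftInverse.injective (g := ⇑(Monoid.CoprodI.lift incl)) (DFunLike.congr_fun hσ')
  have h_lift : Function.Injective (Monoid.CoprodI.lift fun b => ψ.comp (incl b)) := by
    refine Monoid.CoprodI.lift_injective_of_ping_pong _ (.inr ⟨false, hcard⟩)
      (fun b => cond b X Y) ?_ ?_ ?_
    · rintro (_ | _)
      exacts [hY, hX]
    · rintro (_ | _) (_ | _) h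
      exacts [absurd rfl h, hXY.symm, hXY, absurd rfl h]
    · rintro (_ | _) (_ | _) h g hg _ ⟨x, hx, rfl⟩
      exacts [absurd rfl h, hH g hg x hx, hG g hg x hx, absurd rfl h]
  rw [← hσ]
  exact h_lift.comp hσ_inj

theorem companionMatrix_cyclotomic_seven :
    (companionMatrix 6 (X ^ 6 + X ^ 5 + X ^ 4 + X ^ 3 + X ^ 2 + X + 1) : Matrix _ _ ℚ) =
      !![0, 0, 0, 0, 0, -1; 1, 0, 0, 0, 0, -1; 0, 1, 0, 0, 0, -1; 0, 0, 1, 0, 0, -1;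
        0, 0, 0, 1, 0, -1; 0, 0, 0, 0, 1, -1] := by
  ext i j
  fin_cases i <;> fin_cases j <;>
    simp [companionMatrix, coeff_X, coeff_one, coeff_X_pow]

theorem companionMatrix_sq_mul_cyclotomic_ten :
    (companionMatrix 6 ((X - 1) ^ 2 * (X ^ 4 - X ^ 3 + X ^ 2 - X + 1)) : Matrix _ _ ℚ) =
      !![0, 0, 0, 0, 0, -1; 1, 0, 0, 0, 0, 3; 0, 1, 0, 0, 0, -4; 0, 0, 1, 0, 0, 4;
        0, 0, 0, 1, 0, -4; 0, 0, 0, 0, 1, 3] := by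
  have h : ((X - 1) ^ 2 * (X ^ 4 - X ^ 3 + X ^ 2 - X + 1) : ℚ[X]) =
      X ^ 6 - C 3 * X ^ 5 + C 4 * X ^ 4 - C 4 * X ^ 3 + C 4 * X ^ 2 - C 3 * X + 1 := by
    simp only [map_ofNat]
    ring
  rw [h]
  ext i j
  fin_cases i <;> fin_cases j <;>
    simp [companionMatrix, coeff_X, coeff_one, coeff_X_pow]

/-- The transvection `T = B * A⁻¹`. -/
def transvectionMatrix : Matrix (Fin 6) (Fin 6) ℚ :=
  !![1, 0, 0, 0, 0, 0; 4, 1, 0, 0, 0, 0; -3, 0, 1, 0, 0, 0; 5, 0, 0, 1, 0, 0;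
    -3, 0, 0, 0, 1, 0; 4, 0, 0, 0, 0, 1]

theorem transvectionMatrix_mul_companionMatrix :
    transvectionMatrix * companionMatrix 6 ((X - 1) ^ 2 * (X ^ 4 - X ^ 3 + X ^ 2 - X + 1)) =
      companionMatrix 6 (X ^ 6 + X ^ 5 + X ^ 4 + X ^ 3 + X ^ 2 + X + 1) := by
  rw [companionMatrix_sq_mul_cyclotomic_ten, companionMatrix_cyclotomic_seven, transvectionMatrix]
  ext i j
  fin_cases i <;> fin_cases j <;> norm_num [Matrix.mul_apply, Fin.sum_univ_succ]

theorem zmod_seven_funext {a b : ZMod 7 → ℚ} (h0 : a 0 = b 0) (h1 : a 1 = b 1) (h2 : a 2 = b 2)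
    (h3 : a 3 = b 3) (h4 : a 4 = b 4) (h5 : a 5 = b 5) (h6 : a 6 = b 6) : a = b := by
  ext j
  fin_cases j
  exacts [h0, h1, h2, h3, h4, h5, h6]

theorem coords_transvectionMatrix_mulVec (x : Fin 6 → ℚ) :
    coords (transvectionMatrix *ᵥ x) = transv 1 (coords x) := by
  have h : transvectionMatrix *ᵥ x = ![x 0, 4 * x 0 + x 1, -3 * x 0 + x 2, 5 * x 0 + x 3,
      -3 * x 0 + x 4, 4 * x 0 + x 5] := by
    ext i
    fin_cases i <;> simp [transvectionMatrix, Matrix.mulVec, dotProduct, Fin.sum_univ_succ]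
  have h_coeff : transvCoeff 0 = 0 ∧ transvCoeff 1 = -4 ∧ transvCoeff 2 = 7 ∧
      transvCoeff 3 = -8 ∧ transvCoeff 4 = 8 ∧ transvCoeff 5 = -7 ∧ transvCoeff 6 = 4 := by decide
  obtain ⟨h0, h1, h2, h3, h4, h5, h6⟩ := h_coeff
  rw [h]
  apply zmod_seven_funext <;> simp [coords_apply, h0, h1, h2, h3, h4, h5, h6] <;> ring

theorem coords_companionMatrix_mulVec (x : Fin 6 → ℚ) :
    coords (companionMatrix 6 (X ^ 6 + X ^ 5 + X ^ 4 + X ^ 3 + X ^ 2 + X + 1) *ᵥ x) =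
      shift 1 (coords x) := by
  have h : companionMatrix 6 (X ^ 6 + X ^ 5 + X ^ 4 + X ^ 3 + X ^ 2 + X + 1) *ᵥ x =
      ![-x 5, x 0 - x 5, x 1 - x 5, x 2 - x 5, x 3 - x 5, x 4 - x 5] := by
    rw [companionMatrix_cyclotomic_seven]
    ext i
    fin_cases i <;> simp [Matrix.mulVec, dotProduct, Fin.sum_univ_succ] <;> ring
  have h_add : (1 + 1 : ZMod 7) = 2 ∧ (2 + 1 : ZMod 7) = 3 ∧ (3 + 1 : ZMod 7) = 4 ∧
      (4 + 1 : ZMod 7) = 5 ∧ (5 + 1 : ZMod 7) = 6 ∧ (6 + 1 : ZMod 7) = 0 := by decide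
  obtain ⟨h1, h2, h3, h4, h5, h6⟩ := h_add
  rw [h]
  apply zmod_seven_funext <;> simp [coords_apply, h1, h2, h3, h4, h5, h6]

theorem coords_injective : Function.Injective coords := by
  intro x y h
  have h0 : x 0 = y 0 := congr_fun h 0
  have h5 : -x 5 = -y 5 := congr_fun h 1
  have h4 : x 5 - x 4 = y 5 - y 4 := congr_fun h 2
  have h3 : x 4 - x 3 = y 4 - y 3 := congr_fun h 3
  have h2 : x 3 - x 2 = y 3 - y 2 := congr_fun h 4
  have h1 : x 2 - x 1 = y 2 - y 1 := congr_fun h 5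
  ext i
  fin_cases i <;> simp <;> linarith

theorem exists_coords_mem_core : ∃ x, coords x ∈ core := by
  have h_ray : rayEntry 2 0 = 1 ∧ rayEntry 2 1 = -3 ∧ rayEntry 2 2 = 3 ∧ rayEntry 2 3 = -2 ∧
      rayEntry 2 4 = 2 ∧ rayEntry 2 5 = -2 ∧ rayEntry 2 6 = 1 := by decide
  obtain ⟨h0, h1, h2, h3, h4, h5, h6⟩ := h_ray
  have h : coords ![1, 2, 0, 2, 0, 3] = ray 2 := by
    apply zmod_seven_funext <;> simp [coords_apply, ray, h0, h1, h2, h3, h4, h5, h6]; norm_num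
  refine ⟨![1, 2, 0, 2, 0, 3], h ▸ ray_mem_cone 2, ?_, ?_⟩
  · simp [coords_apply]
  · simp [kappa_apply, coords_apply]
    norm_num

end HypergeometricPingPong

/-- The hypergeometric group of case C58 is isomorphic to `ℤ ∗ ℤ/7ℤ`, freely
generated by `T = B * A⁻¹` (of infinite order) and `B` (of order 7). -/
theorem thm_C58 (A B : GL (Fin 6) ℚ)
    (hA : (A : Matrix (Fin 6) (Fin 6) ℚ) = companionMatrix 6 ((X - 1) ^ 2 * (X ^ 4 - X ^ 3 + X ^ 2 - X + 1)))
    (hB : (B : Matrix (Fin 6) (Fin 6) ℚ) = companionMatrix 6 (X ^ 6 + X ^ 5 + X ^ 4 + X ^ 3 + X ^ 2 + X + 1)) :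
    B ^ 7 = 1 ∧ B ≠ 1 ∧ ¬ IsOfFinOrder (B * A⁻¹) ∧
      ∀ ψ : Monoid.Coprod (Multiplicative ℤ) (Multiplicative (ZMod 7)) →* GL (Fin 6) ℚ,
        ψ (Monoid.Coprod.inl (Multiplicative.ofAdd (1 : ℤ))) = B * A⁻¹ →
        ψ (Monoid.Coprod.inr (Multiplicative.ofAdd (1 : ZMod 7))) = B →
        Function.Injective ψ := by
  open HypergeometricPingPong in
  have hT : ((B * A⁻¹ : GL (Fin 6) ℚ) : Matrix (Fin 6) (Fin 6) ℚ) = transvectionMatrix := by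
    rw [← Units.mul_left_inj A, ← Units.val_mul, inv_mul_cancel_right, hA, hB,
      transvectionMatrix_mul_companionMatrix]
  have hT_smul (x : Fin 6 → ℚ) :
      coords (GeneralLinearGroup.toLin (B * A⁻¹) • x) = transv 1 (coords x) := by
    rw [← coords_transvectionMatrix_mulVec, ← hT]
    rfl
  have hB_smul (x : Fin 6 → ℚ) :
      coords (GeneralLinearGroup.toLin B • x) = shift 1 (coords x) := by
    rw [← coords_companionMatrix_mulVec, ← hB]
    rfl
  have hT_zpow := map_zpow_smul_eq_transv coords hT_smul
  have hB_pow := map_pow_smul_eq_shift coords hB_smul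
  obtain ⟨v, hv⟩ := exists_coords_mem_core
  have hv_pos : 0 < coords v 0 := hv.2.1
  refine ⟨?_, ?_, ?_, ?_⟩
  · refine GeneralLinearGroup.toLin.injective (Units.ext (LinearMap.ext fun x => ?_))
    rw [map_pow, map_one]
    refine coords_injective ((hB_pow 7 x).trans ?_)
    rw [show ((7 : ℕ) : ZMod 7) = 0 from rfl]
    ext j
    simp
  · rintro rfl
    have h := congr_fun (congr_fun hB 0) 0
    rw [companionMatrix_cyclotomic_seven] at h
    simp at h
  · rw [isOfFinOrder_iff_pow_eq_one]
    rintro ⟨n, hn, h⟩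
    have h' := congr_fun (hT_zpow n v) 1
    rw [zpow_natCast, ← map_pow, h, map_one, one_smul, transv_apply,
      show transvCoeff 1 = -4 by decide] at h'
    push_cast at h'
    have : 0 < (n : ℚ) * coords v 0 := by positivity
    linarith
  · intro ψ hψT hψB
    have h_inj : Function.Injective (GeneralLinearGroup.toLin.toMonoidHom.comp ψ) := by
      refine coprod_injective_of_ping_pong _ (coords ⁻¹' domT) (coords ⁻¹' domB)
        ⟨v, core_subset_domT hv⟩
        ⟨GeneralLinearGroup.toLin B • v, ?_⟩ (disjoint_domT_domB.preimage coords) ?_ ?_ ?_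
      · rw [Set.mem_preimage, hB_smul]
        exact shift_mem_domB (by decide) (core_subset_domT hv)
      · intro g hg y hy
        have h : Monoid.Coprod.inl g = (Monoid.Coprod.inl (Multiplicative.ofAdd (1 : ℤ)) :
            Monoid.Coprod (Multiplicative ℤ) (Multiplicative (ZMod 7))) ^ g.toAdd := by
          rw [← map_zpow, ← ofAdd_zsmul, zsmul_one, Int.cast_id, ofAdd_toAdd]
        have h' : coords (GeneralLinearGroup.toLin (ψ (Monoid.Coprod.inl g)) • y) =
            transv g.toAdd (coords y) := by
          rw [h, map_zpow, hψT, map_zpow, hT_zpow]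
        change coords (GeneralLinearGroup.toLin (ψ (Monoid.Coprod.inl g)) • y) ∈ domT
        rw [h']
        exact transv_mem_domT hg hy
      · intro g hg x hx
        have h : Monoid.Coprod.inr g = (Monoid.Coprod.inr (Multiplicative.ofAdd (1 : ZMod 7)) :
            Monoid.Coprod (Multiplicative ℤ) (Multiplicative (ZMod 7))) ^ g.toAdd.val := by
          rw [← map_pow, ← ofAdd_nsmul, nsmul_one, ZMod.natCast_zmod_val, ofAdd_toAdd]
        have h' : coords (GeneralLinearGroup.toLin (ψ (Monoid.Coprod.inr g)) • x) =
            shift g.toAdd (coords x) := by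
          rw [h, map_pow, hψB, map_pow, hB_pow, ZMod.natCast_zmod_val]
        change coords (GeneralLinearGroup.toLin (ψ (Monoid.Coprod.inr g)) • x) ∈ domB
        rw [h']
        exact shift_mem_domB hg hx
      · rw [show Cardinal.mk (Multiplicative (ZMod 7)) = 7 from Cardinal.mk_fin 7]
        norm_num
    exact Function.Injective.of_comp (f := GeneralLinearGroup.toLin) h_inj
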